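/- arXiv:2001.10809 — 4 statements merged into one kernel-verified Lean document; each statement's English description precedes it below -/
import Mathlib

section
/- Let G be a connected simple graph on n vertices and let τ be a natural number with 2 ≤ τ ≤ n. Then there exists a set C of vertices of G such that every vertex of G is at distance at most τ from some vertex of C, and τ · |C| ≤ 4n. -/
namespace SimpleGraph

variable {V : Type*} {G : SimpleGraph V}

/-- Every value below `G.dist u v` is attained as a distance from `u`. -/
lemma Connected.exists_dist_eq_of_le (hG : G.Connected) {u v : V} {i : ℕ}
    (hi : i ≤ G.dist u v) : ∃ w, G.dist u w = i := by
  obtain ⟨p, hp⟩ := hG.exists_walk_length_eq_dist u v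
  refine ⟨p.getVert i, ?_⟩
  have h₁ := dist_le (p.take i)
  have h₂ := dist_le (p.drop i)
  have h₃ := hG.dist_triangle (u := u) (v := p.getVert i) (w := v)
  rw [Walk.take_length] at h₁
  rw [Walk.drop_length] at h₂
  omega

/-- A ball of radius at most the distance from its centre to some vertex has more vertices than
its radius. -/
lemma Connected.lt_card_ball [Fintype V] (hG : G.Connected) {u v : V} {r : ℕ}
    (hr : r ≤ G.dist u v) : r < (Finset.univ.filter fun w => G.dist u w ≤ r).card := by
  have hsub : Finset.range (r + 1) ⊆
      (Finset.univ.filter fun w => G.dist u w ≤ r).image (G.dist u) := by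
    intro i hi
    have hir : i ≤ r := Nat.lt_succ_iff.mp (Finset.mem_range.mp hi)
    obtain ⟨w, rfl⟩ := hG.exists_dist_eq_of_le (hir.trans hr)
    exact Finset.mem_image_of_mem _ (by simpa using hir)
  simpa using (Finset.card_le_card hsub).trans Finset.card_image_le

/-- In a finite graph there is a `τ`-separated set of vertices that is also a `τ`-cover. -/
lemma exists_separated_cover [Finite V] (G : SimpleGraph V) (τ : ℕ) :
    ∃ C : Finset V, (C : Set V).Pairwise (fun u v => τ < G.dist u v) ∧
      ∀ v, ∃ c ∈ C, G.dist v c ≤ τ := by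
  classical
  obtain ⟨C, hC⟩ := (Set.toFinite
    {C : Finset V | (C : Set V).Pairwise (fun u v => τ < G.dist u v)}).exists_maximal
    ⟨∅, by simp⟩
  refine ⟨C, hC.prop, fun v => ?_⟩
  by_contra! hv
  have hins : insert v C ∈
      {C : Finset V | (C : Set V).Pairwise (fun u v => τ < G.dist u v)} := by
    rw [Set.mem_ofPred_eq, Finset.coe_insert]
    refine hC.prop.insert fun c hc _ => ⟨hv c hc, ?_⟩
    rw [dist_comm]
    exact hv c hc
  have hmem : v ∈ C := hC.le_of_ge hins (Finset.subset_insert v C) (Finset.mem_insert_self v C)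
  simpa using hv v hmem

/-- A `τ`-separated set with at least two vertices has at most `n / (⌊τ / 2⌋ + 1)` vertices. -/
lemma Connected.card_mul_le_of_separated [Fintype V] (hG : G.Connected) {τ : ℕ} {C : Finset V}
    (hC : (C : Set V).Pairwise (fun u v => τ < G.dist u v)) (h : 1 < C.card) :
    C.card * (τ / 2 + 1) ≤ Fintype.card V := by
  classical
  have hdisj : (C : Set V).PairwiseDisjoint
      fun c => Finset.univ.filter fun w => G.dist c w ≤ τ / 2 := by
    intro a ha b hb hab
    refine Finset.disjoint_left.mpr fun w hwa hwb => ?_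
    simp only [Finset.mem_filter, Finset.mem_univ, true_and] at hwa hwb
    have h₁ := hC ha hb hab
    have h₂ := hG.dist_triangle (u := a) (v := w) (w := b)
    rw [dist_comm] at hwb
    omega
  calc C.card * (τ / 2 + 1)
      ≤ ∑ c ∈ C, (Finset.univ.filter fun w => G.dist c w ≤ τ / 2).card := by
        rw [← smul_eq_mul]
        refine Finset.card_nsmul_le_sum _ _ _ fun c hc => ?_
        obtain ⟨b, hb, hbc⟩ := Finset.exists_mem_ne h c
        have := hC hc hb hbc.symm
        exact hG.lt_card_ball (v := b) (by omega)
    _ = (C.biUnion fun c => Finset.univ.filter fun w => G.dist c w ≤ τ / 2).card :=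
        (Finset.card_biUnion hdisj).symm
    _ ≤ Fintype.card V := Finset.card_le_univ _

end SimpleGraph

/-- Let `G` be a connected simple graph on `n` vertices and let `τ` be a
natural number with `2 ≤ τ ≤ n`. Then there exists a set `C` of vertices of `G` such that
every vertex of `G` is at distance at most `τ` from some vertex of `C`, and `τ * |C| ≤ 4n`. -/
theorem exists_small_cover {V : Type*} [Fintype V] (G : SimpleGraph V) (hG : G.Connected)
    (n τ : ℕ) (hn : Fintype.card V = n) (hτ2 : 2 ≤ τ) (hτn : τ ≤ n) :
    ∃ C : Set V, (∀ v : V, ∃ c ∈ C, G.dist v c ≤ τ) ∧ τ * C.ncard ≤ 4 * n := by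
  obtain ⟨C, hsep, hcov⟩ := G.exists_separated_cover τ
  refine ⟨C, by simpa using hcov, ?_⟩
  rw [Set.ncard_coe_finset]
  rcases le_or_gt C.card 1 with h | h
  · nlinarith
  · have hcard := hG.card_mul_le_of_separated hsep h
    have hτ : τ ≤ 2 * (τ / 2 + 1) := by omega
    nlinarith [Nat.mul_le_mul_right C.card hτ]
end

section
/- Let G be a connected simple graph, let u, v be vertices, and let p be a walk in G from u to v whose length equals dist_G(u,v). Then for every vertex c and every natural number R, the number of vertices w in the support of p satisfying dist_G(c,w) ≤ R is at most 2R+1. -/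
/-- Along a shortest walk, every vertex is reached after exactly its distance from the start. -/
theorem SimpleGraph.Walk.getVert_dist_of_mem_support {V : Type*} {G : SimpleGraph V} {u v w : V}
    {p : G.Walk u v} (hp : p.length = G.dist u v) (hw : w ∈ p.support) :
    p.getVert (G.dist u w) = w := by
  classical
  rw [← SimpleGraph.length_eq_dist_of_subwalk hp (p.isSubwalk_takeUntil hw)]
  exact p.getVert_length_takeUntil hw

/-- Let `G` be a connected simple graph, `u, v` vertices, and `p` a walk
from `u` to `v` whose length equals `dist_G(u,v)` (a shortest path). Then for every vertex
`c` and natural number `R`, the number of vertices `w` in the support of `p` with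
`dist_G(c,w) ≤ R` is at most `2R + 1`. -/
theorem shortest_path_ball_intersection {V : Type*} [Fintype V] [DecidableEq V]
    (G : SimpleGraph V) (hG : G.Connected) (u v : V) (p : G.Walk u v)
    (hp : p.length = G.dist u v) (c : V) (R : ℕ) :
    (p.support.toFinset.filter (fun w => G.dist c w ≤ R)).card ≤ 2 * R + 1 := by
  calc
    _ ≤ (Finset.Icc (G.dist u c - R) (G.dist u c + R)).card := by
      refine Finset.card_le_card_of_injOn (G.dist u) (fun w hw ↦ ?_) (fun w hw w' hw' h ↦ ?_)
      · have hcw : G.dist c w ≤ R := (Finset.mem_filter.mp hw).2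
        have huw := hG.dist_triangle (u := u) (v := c) (w := w)
        have huc := hG.dist_triangle (u := u) (v := w) (w := c)
        rw [G.dist_comm (u := w)] at huc
        simp only [Finset.coe_Icc, Set.mem_Icc]
        omega
      · have hw := List.mem_toFinset.mp (Finset.mem_filter.mp hw).1
        have hw' := List.mem_toFinset.mp (Finset.mem_filter.mp hw').1
        rw [← SimpleGraph.Walk.getVert_dist_of_mem_support hp hw, h,
          SimpleGraph.Walk.getVert_dist_of_mem_support hp hw']
    _ ≤ 2 * R + 1 := by
      rw [Nat.card_Icc]
      omega
end

section
/- Let G be a connected simple graph with m edges, let μ ≥ 1 and r ≥ 1 be natural numbers, let u, v be vertices and let p be a walk in G from u to v whose length equals dist_G(u,v). Let S be the set of vertices w in the support of p such that the number of edges of G lying inside the ball B_G(w,r) is greater than μ. Then μ · |S| ≤ (4r+1) · m. -/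
/-- A vertex on a shortest path from `u` is determined by its distance to `u`. -/
theorem SimpleGraph.Walk.getVert_dist_of_length_eq_dist {V : Type*} {G : SimpleGraph V}
    (hG : G.Connected) {u v w : V} (p : G.Walk u v) (hp : p.length = G.dist u v)
    (hw : w ∈ p.support) : p.getVert (G.dist u w) = w := by
  classical
  have hlen : (p.takeUntil w hw).length = G.dist u w := by
    have hsplit := congrArg SimpleGraph.Walk.length (p.take_spec hw)
    rw [SimpleGraph.Walk.length_append] at hsplit
    have hu := SimpleGraph.dist_le (p.takeUntil w hw)
    have hv := SimpleGraph.dist_le (p.dropUntil w hw)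
    have htri := hG.dist_triangle (u := u) (v := w) (w := v)
    omega
  rw [← hlen, SimpleGraph.Walk.getVert_length_takeUntil]

/-- A ball of radius `r` meets a shortest path in at most `2 * r + 1` vertices. -/
theorem SimpleGraph.Walk.card_filter_dist_le {V : Type*} [DecidableEq V] {G : SimpleGraph V}
    (hG : G.Connected) {u v : V} (p : G.Walk u v) (hp : p.length = G.dist u v)
    (x : V) (r : ℕ) :
    (p.support.toFinset.filter (fun w => G.dist w x ≤ r)).card ≤ 2 * r + 1 := by
  calc
    _ ≤ (Finset.Icc (G.dist u x - r) (G.dist u x + r)).card := by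
      refine Finset.card_le_card_of_injOn (fun w => G.dist u w) ?_ ?_
      · intro w hw
        simp only [Finset.coe_filter, Set.mem_ofPred_eq] at hw
        have h₁ := hG.dist_triangle (u := u) (v := w) (w := x)
        have h₂ := hG.dist_triangle (u := u) (v := x) (w := w)
        rw [G.dist_comm (u := x)] at h₂
        simp only [Finset.coe_Icc, Set.mem_Icc]
        omega
      · intro a ha b hb hab
        simp only [Finset.coe_filter, List.mem_toFinset, Set.mem_ofPred_eq] at ha hb
        rw [← p.getVert_dist_of_length_eq_dist hG hp ha.1,
          ← p.getVert_dist_of_length_eq_dist hG hp hb.1]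
        exact congrArg p.getVert hab
    _ ≤ 2 * r + 1 := by
      rw [Nat.card_Icc]
      omega

/-- Let `G` be a connected simple graph with `m` edges, `μ ≥ 1`, `r ≥ 1`,
and let `p` be a shortest path (a walk of length `dist_G(u,v)`) from `u` to `v`. Let `S` be
the set of vertices `w` on `p` such that more than `μ` edges of `G` lie inside the ball
`B_G(w,r)` (the `(μ,r)`-heavy vertices of `p`). Then `μ * |S| ≤ (4r+1) * m`. -/
theorem heavy_vertices_on_shortest_path {V : Type*} [Fintype V] [DecidableEq V]
    (G : SimpleGraph V) (hG : G.Connected)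
    (m μ r : ℕ) (hm : G.edgeSet.ncard = m) (hμ : 1 ≤ μ) (hr : 1 ≤ r)
    (u v : V) (p : G.Walk u v) (hp : p.length = G.dist u v) :
    μ * (p.support.toFinset.filter
        (fun w => μ < {e : Sym2 V | e ∈ G.edgeSet ∧ ∀ x ∈ e, G.dist w x ≤ r}.ncard)).card
      ≤ (4 * r + 1) * m := by
  classical
  have hcount := Finset.card_mul_le_card_mul
    (s := p.support.toFinset.filter
      (fun w => μ < {e : Sym2 V | e ∈ G.edgeSet ∧ ∀ x ∈ e, G.dist w x ≤ r}.ncard))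
    (t := G.edgeFinset) (m := μ) (n := 2 * r + 1)
    (fun w e => ∀ x ∈ e, G.dist w x ≤ r) ?_ ?_
  · rw [← SimpleGraph.coe_edgeFinset, Set.ncard_coe_finset] at hm
    rw [hm] at hcount
    nlinarith
  · intro w hw
    refine (Finset.mem_filter.mp hw).2.le.trans_eq ?_
    rw [← Set.ncard_coe_finset]
    congr 1
    ext e
    simp [Finset.bipartiteAbove]
  · intro e _
    induction e using Sym2.ind with
    | _ x y =>
      refine le_trans (Finset.card_le_card ?_) (p.card_filter_dist_le hG hp x r)
      intro w hw
      simp only [Finset.bipartiteBelow, Finset.mem_filter] at hw ⊢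
      exact ⟨hw.1.1, hw.2 x (Sym2.mem_mk_left x y)⟩
end

section
/- Let G be a connected simple graph, let ε be a real number with 0 < ε ≤ 1, and set b = 1 + 4/ε. Let j ≥ 1 be a natural number and let u, v, p, p′ be vertices of G such that dist_G(p′,u) ≤ 2^{j−1}, dist_G(p′,v) ≥ b·2^{j−1} (as real numbers), and dist_G(p,u) ≤ 2^{j}. Then dist_G(u,p) + dist_G(p,v) ≤ (1+ε) · dist_G(u,v). -/
/-- Let `G` be a connected simple graph, `0 < ε ≤ 1` real, and
`b = 1 + 4/ε`. Let `j ≥ 1` and `u, v, p, p'` vertices with `dist_G(p',u) ≤ 2^(j-1)`,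
`dist_G(p',v) ≥ b·2^(j-1)` (as reals) and `dist_G(p,u) ≤ 2^j`. Then
`dist_G(u,p) + dist_G(p,v) ≤ (1+ε) · dist_G(u,v)`. -/
theorem apsp_stretch {V : Type*} (G : SimpleGraph V) (hG : G.Connected)
    (ε : ℝ) (hε0 : 0 < ε) (hε1 : ε ≤ 1) (b : ℝ) (hb : b = 1 + 4 / ε)
    (j : ℕ) (hj : 1 ≤ j) (u v p p' : V)
    (h1 : (G.dist p' u : ℝ) ≤ 2 ^ (j - 1))
    (h2 : b * 2 ^ (j - 1) ≤ (G.dist p' v : ℝ))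
    (h3 : G.dist p u ≤ 2 ^ j) :
    (G.dist u p : ℝ) + (G.dist p v : ℝ) ≤ (1 + ε) * (G.dist u v : ℝ) := by
  have hp' : (G.dist p' v : ℝ) ≤ G.dist p' u + G.dist u v := by
    exact_mod_cast hG.dist_triangle
  have hp : (G.dist p v : ℝ) ≤ G.dist p u + G.dist u v := by
    exact_mod_cast hG.dist_triangle
  have hpu : (G.dist p u : ℝ) ≤ 2 * 2 ^ (j - 1) := by
    rw [← pow_succ', Nat.sub_add_cancel hj]
    exact_mod_cast h3
  have hfar : 4 / ε * 2 ^ (j - 1) ≤ (G.dist u v : ℝ) := by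
    rw [hb] at h2
    linarith
  have hscaled : 4 * 2 ^ (j - 1) ≤ ε * (G.dist u v : ℝ) := by
    calc (4 : ℝ) * 2 ^ (j - 1) = ε * (4 / ε * 2 ^ (j - 1)) := by field_simp
      _ ≤ ε * (G.dist u v : ℝ) := by gcongr
  rw [G.dist_comm (u := u) (v := p)]
  linarith
end
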